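/- The limit as n tends to infinity of d(n,0)/(n * z(n)) exists and equals 2/3 - sqrt(3)/(2*pi); in other words, for large n, the probability that a vertex chosen uniformly at random from all n * z(n) vertices of all plane 1-2 trees on [n] is a leaf tends to 2/3 - sqrt(3)/(2*pi). -/

import Mathlib

namespace BalancedTrees

/-- Plane binary trees with vertices labeled by natural numbers;
`nil` is the empty tree, and each child of a vertex is designated
as a left child or a right child. -/
inductive BT where
  | nil : BT
  | node (label : ℕ) (l r : BT) : BT
deriving DecidableEq

namespace BT

/-- `balRank t = some k` if and only if the root of `t` is a balanced vertex of
rank `k`, i.e. every descending path from the root to a leaf has length `k`. -/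
def balRank : BT → Option ℕ
  | .nil => none
  | .node _ .nil .nil => some 0
  | .node _ .nil (.node b rl rr) => (balRank (BT.node b rl rr)).map (· + 1)
  | .node _ (.node a ll lr) .nil => (balRank (BT.node a ll lr)).map (· + 1)
  | .node _ (.node a ll lr) (.node b rl rr) =>
      match balRank (BT.node a ll lr), balRank (BT.node b rl rr) with
      | some i, some j => if i = j then some (i + 1) else none
      | _, _ => none

/-- The number of balanced vertices of rank `k` in the tree `t`. -/
def countBal (k : ℕ) : BT → ℕ
  | .nil => 0
  | .node v l r =>
      countBal k l + countBal k r +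
        (if balRank (BT.node v l r) = some k then 1 else 0)

/-- The number of balanced vertices (of any rank) in the tree `t`. -/
def countBalAll : BT → ℕ
  | .nil => 0
  | .node v l r =>
      countBalAll l + countBalAll r +
        (if (balRank (BT.node v l r)).isSome then 1 else 0)

/-- Auxiliary, fuelled version of `treeOf`. -/
def treeOfAux : ℕ → List ℕ → BT
  | 0, _ => .nil
  | _ + 1, [] => .nil
  | fuel + 1, l =>
      let m := l.foldr max 0
      BT.node m (treeOfAux fuel (l.takeWhile (· != m)))
                (treeOfAux fuel ((l.dropWhile (· != m)).tail))

/-- The decreasing binary tree `T(π)` of a sequence `π` of distinct labels: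
the root is the maximum entry, and its left (resp. right) subtree is built
recursively from the part of the sequence to the left (resp. right) of the
maximum. This is a bijection between permutations of `{1,…,n}` and
decreasing binary trees on `{1,…,n}`. -/
def treeOf (l : List ℕ) : BT := treeOfAux l.length l

/-- Canonical form for non-plane 1-2 trees (as represented by plane trees):
an only child is stored as a left child, and of two (unordered) children the
one with the larger label is stored on the left. Decreasing binary trees in
canonical form are in bijection with non-plane 1-2 trees. -/
def canonNP : BT → Bool
  | .nil => true
  | .node _ l r =>
      canonNP l && canonNP r &&
        (match l, r with
         | .nil, .nil => true
         | .node _ _ _, .nil => true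
         | .nil, .node _ _ _ => false
         | .node a _ _, .node b _ _ => decide (b < a))

/-- Canonical form for plane 1-2 trees: an only child is stored as a left
child (an only child carries no left/right designation), while two children
remain ordered. Decreasing binary trees in canonical form are in bijection
with plane 1-2 trees. -/
def canonP : BT → Bool
  | .nil => true
  | .node _ l r =>
      canonP l && canonP r &&
        (match l, r with
         | .nil, .node _ _ _ => false
         | _, _ => true)

end BT

open BT

/-- The list of all permutations of `{1,…,n}`, each written as a list. -/
def perms (n : ℕ) : List (List ℕ) := (List.range' 1 n).permutations

/-- `a n k`: the total number of balanced vertices of rank `k` over all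
decreasing binary trees on `{1,…,n}`. -/
def a (n k : ℕ) : ℕ := ((perms n).map fun l => countBal k (treeOf l)).sum

/-- `r n k`: the number of decreasing binary trees on `{1,…,n}` whose root is
balanced of rank `k`. -/
def r (n k : ℕ) : ℕ :=
  ((perms n).filter fun l => decide (balRank (treeOf l) = some k)).length

/-- `p n k`: the probability that the root of a uniformly random decreasing
binary tree on `{1,…,n}` is balanced of rank `k`; by convention `p 0 k = 1`. -/
def p (n k : ℕ) : ℚ := if n = 0 then 1 else (r n k : ℚ) / (Nat.factorial n : ℚ)

/-- The number of decreasing binary trees on `{1,…,n}` whose root is balanced. -/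
def rootBal (n : ℕ) : ℕ :=
  ((perms n).filter fun l => (balRank (treeOf l)).isSome).length

/-- `proot n`: the probability that the root of a uniformly random decreasing
binary tree on `{1,…,n}` is balanced. -/
def proot (n : ℕ) : ℚ := (rootBal n : ℚ) / (Nat.factorial n : ℚ)

/-- The total number of balanced vertices over all decreasing binary trees
on `{1,…,n}`. -/
def totalBal (n : ℕ) : ℕ := ((perms n).map fun l => countBalAll (treeOf l)).sum

/-- `Pbal n`: the probability that a vertex chosen uniformly at random from
the `n * n!` vertices of all decreasing binary trees on `{1,…,n}` is balanced. -/
def Pbal (n : ℕ) : ℚ := (totalBal n : ℚ) / ((n : ℚ) * (Nat.factorial n : ℚ))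

/-- Permutations whose decreasing binary tree is a canonical representative
of a non-plane 1-2 tree; these are in bijection with non-plane 1-2 trees
on `{1,…,n}`. -/
def npPerms (n : ℕ) : List (List ℕ) := (perms n).filter fun l => canonNP (treeOf l)

/-- `E n`: the number of non-plane 1-2 trees on `{1,…,n}` (the Euler number). -/
def E (n : ℕ) : ℕ := (npPerms n).length

/-- `b n k`: the total number of balanced vertices of rank `k` over all
non-plane 1-2 trees on `{1,…,n}`. -/
def b (n k : ℕ) : ℕ := ((npPerms n).map fun l => countBal k (treeOf l)).sum

/-- `s n k`: the number of non-plane 1-2 trees on `{1,…,n}` whose root is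
balanced of rank `k`. -/
def s (n k : ℕ) : ℕ :=
  ((npPerms n).filter fun l => decide (balRank (treeOf l) = some k)).length

/-- Permutations whose decreasing binary tree is a canonical representative
of a plane 1-2 tree; these are in bijection with plane 1-2 trees on `{1,…,n}`. -/
def pPerms (n : ℕ) : List (List ℕ) := (perms n).filter fun l => canonP (treeOf l)

/-- `z n`: the number of plane 1-2 trees on `{1,…,n}`. -/
def z (n : ℕ) : ℕ := (pPerms n).length

/-- `d n k`: the total number of balanced vertices of rank `k` over all
plane 1-2 trees on `{1,…,n}`. -/
def d (n k : ℕ) : ℕ := ((pPerms n).map fun l => countBal k (treeOf l)).sum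

/-- `t n k`: the number of plane 1-2 trees on `{1,…,n}` whose root is
balanced of rank `k`. -/
def t (n k : ℕ) : ℕ :=
  ((pPerms n).filter fun l => decide (balRank (treeOf l) = some k)).length

end BalancedTrees

namespace BalancedTrees

open BT Finset PowerSeries

lemma foldr_max_eq {l : List ℕ} {m : ℕ} (hm : m ∈ l) (h : ∀ x ∈ l, x ≤ m) :
    l.foldr max 0 = m := by
  induction l with
  | nil => simp at hm
  | cons a l ih =>
    rw [List.foldr_cons]
    have hle : l.foldr max 0 ≤ m :=
      List.max_le_of_forall_le l m fun x hx => h x (List.mem_cons_of_mem _ hx)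
    rcases List.mem_cons.1 hm with rfl | hm
    · exact max_eq_left hle
    · rw [ih hm fun x hx => h x (List.mem_cons_of_mem _ hx)]
      exact max_eq_right (h a (by simp))

lemma takeWhile_append_cons {l₁ l₂ : List ℕ} {m : ℕ} (h : m ∉ l₁) :
    (l₁ ++ m :: l₂).takeWhile (· != m) = l₁ := by
  rw [List.takeWhile_append_of_pos (by intro x hx; simpa using ne_of_mem_of_not_mem hx h)]
  simp

lemma dropWhile_append_cons {l₁ l₂ : List ℕ} {m : ℕ} (h : m ∉ l₁) :
    (l₁ ++ m :: l₂).dropWhile (· != m) = m :: l₂ := by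
  rw [List.dropWhile_append_of_pos (by intro x hx; simpa using ne_of_mem_of_not_mem hx h)]
  simp

lemma treeOfAux_eq_treeOf {n : ℕ} {l : List ℕ} (h : l.length ≤ n) :
    treeOfAux n l = treeOf l := by
  suffices H : ∀ k n (l : List ℕ), l.length ≤ n → l.length ≤ k →
      treeOfAux n l = treeOfAux k l from H _ _ _ h le_rfl
  intro k
  induction k with
  | zero =>
    intro n l _ hk
    obtain rfl : l = [] := by simpa using hk
    cases n <;> rfl
  | succ k ih =>
    intro n l hn hk
    cases l with
    | nil => cases n <;> rfl
    | cons x t =>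
      obtain ⟨n, rfl⟩ : ∃ n', n = n' + 1 := ⟨n - 1, by simp at hn; omega⟩
      set m := (x :: t).foldr max 0 with hm
      have hmem : ∃ y ∈ x :: t, ¬ (y != m) = true := by
        by_contra! hne
        obtain ⟨y, hy, hmax⟩ := (x :: t).toFinset.exists_max_image id ⟨x, by simp⟩
        have := foldr_max_eq (List.mem_toFinset.1 hy) fun z hz => hmax z (List.mem_toFinset.2 hz)
        have h2 := hne y (List.mem_toFinset.1 hy)
        rw [hm, this] at h2
        simp at h2
      have hsplit := List.takeWhile_append_dropWhile (p := (· != m)) (l := x :: t)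
      have hdrop : (x :: t).dropWhile (· != m) ≠ [] := by
        intro e
        rw [List.dropWhile_eq_nil_iff] at e
        obtain ⟨y, hy, hy'⟩ := hmem
        exact hy' (e y hy)
      have hlen := congrArg List.length hsplit
      rw [List.length_append] at hlen
      have hpos := List.length_pos_iff.2 hdrop
      have e : ∀ j, treeOfAux (j + 1) (x :: t) =
        BT.node m (treeOfAux j ((x :: t).takeWhile (· != m)))
          (treeOfAux j (((x :: t).dropWhile (· != m)).tail)) := fun j => rfl
      rw [e, e, ih n _ (by omega) (by omega),
        ih n _ (by rw [List.length_tail]; omega) (by rw [List.length_tail]; omega)]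

lemma treeOf_nil : treeOf [] = .nil := rfl

lemma treeOf_append_cons {l₁ l₂ : List ℕ} {m : ℕ} (h₁ : ∀ x ∈ l₁, x < m) (h₂ : ∀ x ∈ l₂, x < m) :
    treeOf (l₁ ++ m :: l₂) = .node m (treeOf l₁) (treeOf l₂) := by
  have hmax : (l₁ ++ m :: l₂).foldr max 0 = m := by
    refine foldr_max_eq (by simp) fun x hx => ?_
    simp only [List.mem_append, List.mem_cons] at hx
    rcases hx with hx | rfl | hx
    exacts [(h₁ x hx).le, le_rfl, (h₂ x hx).le]
  have hm : m ∉ l₁ := fun h => (h₁ m h).false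
  have hne : l₁ ++ m :: l₂ ≠ [] := by simp
  have hstep : ∀ (j : ℕ) (l : List ℕ), l ≠ [] → treeOfAux (j + 1) l =
      BT.node (l.foldr max 0) (treeOfAux j (l.takeWhile (· != l.foldr max 0)))
        (treeOfAux j ((l.dropWhile (· != l.foldr max 0)).tail)) := by
    rintro j (_ | ⟨x, t⟩) h
    exacts [absurd rfl h, rfl]
  rw [← treeOfAux_eq_treeOf (Nat.le_succ _), hstep _ _ hne, hmax, takeWhile_append_cons hm,
    dropWhile_append_cons hm, List.tail_cons, treeOfAux_eq_treeOf (by simp),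
    treeOfAux_eq_treeOf (by simp; omega)]

lemma treeOf_eq_nil {l : List ℕ} : treeOf l = .nil ↔ l = [] := by
  cases l with
  | nil => simp [treeOf_nil]
  | cons x t => simp [treeOf, treeOfAux]

/-- The arrangements of a finite set of labels as lists without repetition. -/
noncomputable def arrangements (S : Finset ℕ) : Finset (List ℕ) := S.toList.permutations.toFinset

lemma mem_arrangements {S : Finset ℕ} {l : List ℕ} :
    l ∈ arrangements S ↔ l.Nodup ∧ l.toFinset = S := by
  rw [arrangements, List.mem_toFinset, List.mem_permutations]
  constructor
  · intro h
    exact ⟨h.nodup_iff.2 S.nodup_toList, by rw [List.toFinset_eq_of_perm _ _ h, S.toList_toFinset]⟩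
  · rintro ⟨h, rfl⟩
    exact (List.toFinset_toList h).symm

lemma arrangements_empty : arrangements ∅ = {[]} := by
  ext l
  rw [mem_arrangements, mem_singleton, List.toFinset_eq_empty_iff]
  exact ⟨fun h => h.2, fun h => ⟨h ▸ List.nodup_nil, h⟩⟩

/-- Splitting an arrangement at its largest label. -/
lemma sum_arrangements_insert {M : Type*} [AddCommMonoid M] (f : BT → M) {T : Finset ℕ} {m : ℕ}
    (hm : ∀ x ∈ T, x < m) :
    ∑ l ∈ arrangements (insert m T), f (treeOf l) =
      ∑ A ∈ T.powerset, ∑ l₁ ∈ arrangements A, ∑ l₂ ∈ arrangements (T \ A),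
        f (.node m (treeOf l₁) (treeOf l₂)) := by
  have hmT : m ∉ T := fun h => (hm m h).false
  simp_rw [← sum_product']
  rw [sum_sigma']
  symm
  refine sum_bij' (fun x _ => x.2.1 ++ m :: x.2.2)
    (fun l _ => ⟨(l.takeWhile (· != m)).toFinset,
      (l.takeWhile (· != m), (l.dropWhile (· != m)).tail)⟩) ?_ ?_ ?_ ?_ ?_
  · rintro ⟨A, l₁, l₂⟩ h
    simp only [mem_sigma, mem_product, mem_powerset, mem_arrangements] at h ⊢
    obtain ⟨hA, ⟨h₁, rfl⟩, h₂, e⟩ := h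
    have e' := Finset.ext_iff.1 e
    simp only [List.mem_toFinset, mem_sdiff] at e'
    refine ⟨?_, ?_⟩
    · rw [List.nodup_append, List.nodup_cons]
      refine ⟨h₁, ⟨fun h => hmT ((e' m).1 h).1, h₂⟩, ?_⟩
      rintro x hx y hy rfl
      rcases List.mem_cons.1 hy with rfl | hy
      · exact hmT (hA (by simpa using hx))
      · exact ((e' x).1 hy).2 hx
    · ext x
      have hx : x ∈ l₁ → x ∈ T := fun h => hA (by simpa using h)
      simp only [List.mem_toFinset, List.mem_append, List.mem_cons, e', mem_insert]
      tauto
  · intro l h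
    rw [mem_arrangements] at h
    obtain ⟨hl, e⟩ := h
    have hml : m ∈ l := by rw [← List.mem_toFinset, e]; simp
    obtain ⟨l₁, l₂, rfl⟩ := List.append_of_mem hml
    rw [List.nodup_append, List.nodup_cons] at hl
    obtain ⟨h₁, ⟨h₂, h₃⟩, h₄⟩ := hl
    have hm₁ : m ∉ l₁ := fun h => h₄ m h m (by simp) rfl
    simp only [takeWhile_append_cons hm₁, dropWhile_append_cons hm₁, List.tail_cons, mem_sigma,
      mem_product, mem_powerset, mem_arrangements, h₁, h₃, true_and, and_true]
    have e' := Finset.ext_iff.1 e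
    simp only [List.mem_toFinset, List.mem_append, List.mem_cons, mem_insert] at e'
    refine ⟨fun x hx => ?_, ?_⟩
    · rw [List.mem_toFinset] at hx
      exact ((e' x).1 (.inl hx)).resolve_left (fun h => hm₁ (h ▸ hx))
    · ext x
      simp only [List.mem_toFinset, mem_sdiff]
      constructor
      · intro hx
        exact ⟨((e' x).1 (.inr (.inr hx))).resolve_left (fun h => h₂ (h ▸ hx)),
          fun hx₁ => h₄ x hx₁ x (by simp [hx]) rfl⟩
      · rintro ⟨hx, hx₁⟩
        exact (((e' x).2 (.inr hx)).resolve_left hx₁).resolve_left (fun h => hmT (h ▸ hx))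
  · rintro ⟨A, l₁, l₂⟩ h
    simp only [mem_sigma, mem_product, mem_powerset, mem_arrangements] at h
    obtain ⟨hA, ⟨h₁, rfl⟩, h₂, e⟩ := h
    have hm₁ : m ∉ l₁ := fun h => hmT (hA (by simpa using h))
    simp only [takeWhile_append_cons hm₁, dropWhile_append_cons hm₁, List.tail_cons]
  · intro l h
    rw [mem_arrangements] at h
    have hml : m ∈ l := by rw [← List.mem_toFinset, h.2]; simp
    obtain ⟨l₁, l₂, rfl⟩ := List.append_of_mem hml
    have hm₁ : m ∉ l₁ := fun h' => (List.nodup_append.1 h.1).2.2 m h' m (by simp) rfl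
    simp only [takeWhile_append_cons hm₁, dropWhile_append_cons hm₁, List.tail_cons]
  · rintro ⟨A, l₁, l₂⟩ h
    simp only [mem_sigma, mem_product, mem_powerset, mem_arrangements] at h
    obtain ⟨hA, ⟨h₁, rfl⟩, h₂, e⟩ := h
    rw [treeOf_append_cons (fun x hx => hm x (hA (by simpa using hx)))]
    intro x hx
    exact hm x (mem_sdiff.1 (e ▸ List.mem_toFinset.2 hx)).1

/-- The indicator of the canonical representatives of plane 1-2 trees. -/
def planeWeight (t : BT) : ℕ := if canonP t then 1 else 0

/-- The number of leaves of a canonical representative of a plane 1-2 tree, and zero on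
all other trees. -/
def leafWeight (t : BT) : ℕ := if canonP t then countBal 0 t else 0

lemma balRank_node_eq_zero (m : ℕ) (l r : BT) :
    balRank (.node m l r) = some 0 ↔ l = .nil ∧ r = .nil := by
  cases l <;> cases r <;> simp [balRank]
  split <;> simp

lemma planeWeight_node (m : ℕ) (l r : BT) :
    planeWeight (.node m l r) + (if l = .nil then planeWeight r else 0) =
      planeWeight l * planeWeight r + (if l = .nil ∧ r = .nil then 1 else 0) := by
  cases l <;> cases r <;> simp [planeWeight, canonP]
  grind

lemma leafWeight_node (m : ℕ) (l r : BT) :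
    leafWeight (.node m l r) + (if l = .nil then leafWeight r else 0) =
      planeWeight l * leafWeight r + leafWeight l * planeWeight r +
        (if l = .nil ∧ r = .nil then 1 else 0) := by
  have h := balRank_node_eq_zero m l r
  rw [leafWeight, countBal, if_congr h rfl rfl]
  cases l <;> cases r <;> simp [planeWeight, leafWeight, canonP, countBal]
  all_goals grind

/-- The total weight of the trees with label set `S`. -/
noncomputable def total (f : BT → ℕ) (S : Finset ℕ) : ℕ := ∑ l ∈ arrangements S, f (treeOf l)

lemma sum_split_left_nil (g : BT → ℕ) (T : Finset ℕ) :
    ∑ A ∈ T.powerset, ∑ l₁ ∈ arrangements A, ∑ l₂ ∈ arrangements (T \ A),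
      (if treeOf l₁ = .nil then g (treeOf l₂) else 0) = total g T := by
  rw [sum_eq_single ∅]
  · simp [arrangements_empty, treeOf_nil, total]
  · intro A _ hA
    refine sum_eq_zero fun l₁ h₁ => sum_eq_zero fun l₂ _ => ?_
    rw [if_neg]
    rw [treeOf_eq_nil]
    rintro rfl
    exact hA (mem_arrangements.1 h₁).2.symm
  · simp

lemma total_nil (T : Finset ℕ) : total (fun t => if t = .nil then 1 else 0) T =
    if #T = 0 then 1 else 0 := by
  simp only [card_eq_zero]
  split_ifs with h
  · rw [h, total, arrangements_empty, sum_singleton, treeOf_nil, if_pos rfl]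
  · refine sum_eq_zero fun l hl => if_neg ?_
    rw [treeOf_eq_nil]
    rintro rfl
    exact h (mem_arrangements.1 hl).2.symm

lemma sum_split_mul (f g : BT → ℕ) (T : Finset ℕ) :
    ∑ A ∈ T.powerset, ∑ l₁ ∈ arrangements A, ∑ l₂ ∈ arrangements (T \ A),
      f (treeOf l₁) * g (treeOf l₂) = ∑ A ∈ T.powerset, total f A * total g (T \ A) := by
  simp only [total, sum_mul_sum]

lemma total_planeWeight_insert {T : Finset ℕ} {m : ℕ} (hm : ∀ x ∈ T, x < m) :
    total planeWeight (insert m T) + total planeWeight T =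
      ∑ A ∈ T.powerset, total planeWeight A * total planeWeight (T \ A) +
        (if #T = 0 then 1 else 0) := by
  rw [total, sum_arrangements_insert _ hm, ← sum_split_left_nil planeWeight, ← sum_split_mul,
    ← total_nil, ← sum_split_left_nil]
  simp only [← sum_add_distrib, planeWeight_node, ite_and]

lemma total_leafWeight_insert {T : Finset ℕ} {m : ℕ} (hm : ∀ x ∈ T, x < m) :
    total leafWeight (insert m T) + total leafWeight T =
      ∑ A ∈ T.powerset, total planeWeight A * total leafWeight (T \ A) +
      ∑ A ∈ T.powerset, total leafWeight A * total planeWeight (T \ A) +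
        (if #T = 0 then 1 else 0) := by
  rw [total, sum_arrangements_insert _ hm, ← sum_split_left_nil leafWeight, ← sum_split_mul,
    ← sum_split_mul, ← total_nil, ← sum_split_left_nil]
  simp only [← sum_add_distrib, leafWeight_node, ite_and]

lemma sum_perms (f : BT → ℕ) (n : ℕ) :
    ((perms n).map fun l => f (treeOf l)).sum = total f (Icc 1 n) := by
  have hnd : (perms n).Nodup := List.nodup_permutations _ (List.nodup_range' ..)
  rw [total, ← List.sum_toFinset _ hnd]
  congr 1
  ext l
  rw [mem_arrangements, List.mem_toFinset, perms, List.mem_permutations]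
  have hr : (List.range' 1 n).toFinset = Icc 1 n := by
    ext x; simp [List.mem_range'_1]; omega
  constructor
  · intro h
    exact ⟨h.nodup_iff.2 (List.nodup_range' ..), by rw [List.toFinset_eq_of_perm _ _ h, hr]⟩
  · rintro ⟨h, e⟩
    exact List.perm_of_nodup_nodup_toFinset_eq h (List.nodup_range' ..) (by rw [e, hr])

lemma z_eq_total (n : ℕ) : z n = total planeWeight (Icc 1 n) := by
  rw [← sum_perms, z, pPerms]
  induction perms n with
  | nil => rfl
  | cons a l ih =>
    by_cases h : canonP (treeOf a) <;> simp [h, planeWeight, ih, add_comm]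

lemma d_eq_total (n : ℕ) : d n 0 = total leafWeight (Icc 1 n) := by
  rw [← sum_perms, d, pPerms]
  induction perms n with
  | nil => rfl
  | cons a l ih => by_cases h : canonP (treeOf a) <;> simp [h, leafWeight, ih]

lemma insert_Icc (n : ℕ) : insert (n + 1) (Icc 1 n) = Icc 1 (n + 1) := by
  ext x; simp; omega

lemma sum_powerset_totals {f g : BT → ℕ} {F G : ℕ → ℕ} {T : Finset ℕ}
    (hf : ∀ A ⊆ T, total f A = F #A) (hg : ∀ A ⊆ T, total g A = G #A) :
    ∑ A ∈ T.powerset, total f A * total g (T \ A) =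
      ∑ i ∈ range (#T + 1), (#T).choose i * F i * G (#T - i) := by
  have := sum_powerset_apply_card (fun i => F i * G (#T - i)) (x := T)
  simp only [smul_eq_mul, ← mul_assoc] at this
  rw [← this]
  refine sum_congr rfl fun A hA => ?_
  rw [mem_powerset] at hA
  rw [hf A hA, hg _ sdiff_subset, card_sdiff_of_subset hA]

lemma totals_eq (S : Finset ℕ) :
    total planeWeight S = z #S ∧ total leafWeight S = d #S 0 := by
  induction hn : #S using Nat.strong_induction_on generalizing S with
  | _ n ih =>
    rcases S.eq_empty_or_nonempty with rfl | hS
    · obtain rfl : 0 = n := by simpa using hn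
      simp [z_eq_total, d_eq_total]
    · set m := S.max' hS
      have hmem : m ∈ S := S.max'_mem hS
      have hlt : ∀ x ∈ S.erase m, x < m := fun x hx =>
        lt_of_le_of_ne (S.le_max' x (mem_of_mem_erase hx)) (ne_of_mem_erase hx)
      obtain ⟨k, rfl⟩ : ∃ k, n = k + 1 := ⟨n - 1, by have := hS.card_pos; omega⟩
      have hcard : #(S.erase m) = k := by rw [card_erase_of_mem hmem, hn]; rfl
      have hcard' : #(Icc 1 k) = k := by simp
      have hz : ∀ T : Finset ℕ, #T = k → ∀ A ⊆ T, total planeWeight A = z #A := fun T hT A hA =>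
        (ih _ (by have := card_le_card hA; omega) A rfl).1
      have hd : ∀ T : Finset ℕ, #T = k → ∀ A ⊆ T, total leafWeight A = d #A 0 := fun T hT A hA =>
        (ih _ (by have := card_le_card hA; omega) A rfl).2
      have hlt' : ∀ x ∈ Icc 1 k, x < k + 1 := fun x hx => by simp at hx; omega
      have a₁ := total_planeWeight_insert hlt
      have a₂ := total_planeWeight_insert hlt'
      have b₁ := total_leafWeight_insert hlt
      have b₂ := total_leafWeight_insert hlt'
      rw [insert_erase hmem, sum_powerset_totals (hz _ hcard) (hz _ hcard), hcard,
        hz _ hcard _ subset_rfl, hcard] at a₁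
      rw [insert_Icc, sum_powerset_totals (hz _ hcard') (hz _ hcard'), hcard',
        hz _ hcard' _ subset_rfl, hcard', ← z_eq_total] at a₂
      rw [insert_erase hmem, sum_powerset_totals (hz _ hcard) (G := fun k => d k 0) (hd _ hcard),
        sum_powerset_totals (F := fun k => d k 0) (hd _ hcard) (hz _ hcard), hcard,
        hd _ hcard _ subset_rfl, hcard] at b₁
      rw [insert_Icc, sum_powerset_totals (hz _ hcard') (G := fun k => d k 0) (hd _ hcard'),
        sum_powerset_totals (F := fun k => d k 0) (hd _ hcard') (hz _ hcard'), hcard',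
        hd _ hcard' _ subset_rfl, hcard', ← d_eq_total] at b₂
      constructor <;> omega

lemma z_zero : z 0 = 1 := by
  rw [z_eq_total, Icc_eq_empty (by simp), total, arrangements_empty, sum_singleton]
  rfl

lemma d_zero : d 0 0 = 0 := by
  rw [d_eq_total, Icc_eq_empty (by simp), total, arrangements_empty, sum_singleton]
  rfl

lemma z_succ (n : ℕ) : z (n + 1) + z n =
    ∑ i ∈ range (n + 1), n.choose i * z i * z (n - i) + (if n = 0 then 1 else 0) := by
  have h := total_planeWeight_insert (T := Icc 1 n) (m := n + 1) fun x hx => by simp at hx; omega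
  rw [insert_Icc, sum_powerset_totals (fun A _ => (totals_eq A).1) (fun A _ => (totals_eq A).1),
    ← z_eq_total, ← z_eq_total] at h
  simpa using h

lemma d_succ (n : ℕ) : d (n + 1) 0 + d n 0 =
    2 * ∑ i ∈ range (n + 1), n.choose i * z i * d (n - i) 0 + (if n = 0 then 1 else 0) := by
  have h := total_leafWeight_insert (T := Icc 1 n) (m := n + 1) fun x hx => by simp at hx; omega
  rw [insert_Icc, sum_powerset_totals (fun A _ => (totals_eq A).1)
      (G := fun k => d k 0) (fun A _ => (totals_eq A).2),
    sum_powerset_totals (F := fun k => d k 0) (fun A _ => (totals_eq A).2) (fun A _ => (totals_eq A).1),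
    ← d_eq_total, ← d_eq_total] at h
  simp only [Nat.card_Icc, add_tsub_cancel_right] at h
  have hswap : ∑ i ∈ range (n + 1), n.choose i * d i 0 * z (n - i) =
      ∑ i ∈ range (n + 1), n.choose i * z i * d (n - i) 0 := by
    rw [← sum_range_reflect]
    refine sum_congr rfl fun i hi => ?_
    have hi : i ≤ n := by simpa [Nat.lt_succ_iff] using hi
    simp only [add_tsub_cancel_right, Nat.sub_sub_self hi, Nat.choose_symm hi]
    ring
  rw [h, hswap, two_mul]

/-- The exponential generating function of a sequence. -/
noncomputable def egf (u : ℕ → ℕ) : ℝ⟦X⟧ := PowerSeries.mk fun n => (u n : ℝ) / n.factorial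

lemma coeff_egf (u : ℕ → ℕ) (n : ℕ) : coeff n (egf u) = (u n : ℝ) / n.factorial := coeff_mk ..

lemma coeff_derivative_egf (u : ℕ → ℕ) (n : ℕ) :
    coeff n (d⁄dX ℝ (egf u)) = (u (n + 1) : ℝ) / n.factorial := by
  rw [coeff_derivative, coeff_egf, Nat.factorial_succ]
  push_cast
  field_simp

lemma coeff_egf_mul (u v : ℕ → ℕ) (n : ℕ) : coeff n (egf u * egf v) =
    ((∑ i ∈ range (n + 1), n.choose i * u i * v (n - i) : ℕ) : ℝ) / n.factorial := by
  rw [coeff_mul, Nat.sum_antidiagonal_eq_sum_range_succ_mk]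
  push_cast
  rw [sum_div]
  refine sum_congr rfl fun i hi => ?_
  have hi : i ≤ n := by simpa [Nat.lt_succ_iff] using hi
  rw [coeff_egf, coeff_egf, Nat.cast_choose ℝ hi]
  field_simp

lemma coeff_one_eq_div_factorial (n : ℕ) :
    coeff n (1 : ℝ⟦X⟧) = ((if n = 0 then 1 else 0 : ℕ) : ℝ) / n.factorial := by
  rw [coeff_one]
  split_ifs with h <;> simp [h]

lemma derivative_egf_z : d⁄dX ℝ (egf z) = egf z ^ 2 - egf z + 1 := by
  rw [← sub_eq_zero]
  ext n
  have h := congrArg (Nat.cast (R := ℝ)) (z_succ n)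
  simp only [map_sub, map_add, pow_two, coeff_derivative_egf, coeff_egf_mul, coeff_egf,
    coeff_one_eq_div_factorial, map_zero]
  rw [Nat.cast_add, Nat.cast_add] at h
  rw [← sub_div, ← add_div, ← sub_div, div_eq_zero_iff]
  left
  linarith

lemma derivative_egf_d :
    d⁄dX ℝ (egf (d · 0)) = 2 * (egf z * egf (d · 0)) - egf (d · 0) + 1 := by
  rw [← sub_eq_zero]
  ext n
  have h := congrArg (Nat.cast (R := ℝ)) (d_succ n)
  simp only [map_sub, map_add, two_mul, coeff_derivative_egf, coeff_egf_mul, coeff_egf,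
    coeff_one_eq_div_factorial, map_zero]
  rw [Nat.cast_add, Nat.cast_add, Nat.cast_mul, Nat.cast_two] at h
  rw [← add_div, ← sub_div, ← add_div, ← sub_div, div_eq_zero_iff]
  left
  linarith

lemma eq_zero_of_derivative_eq_mul {F G : ℝ⟦X⟧} (h : d⁄dX ℝ F = G * F) (h0 : coeff 0 F = 0) :
    F = 0 := by
  ext n
  induction n using Nat.strong_induction_on with
  | _ n ih =>
    cases n with
    | zero => simpa using h0
    | succ n =>
      have hn := congrArg (coeff n) h
      rw [coeff_derivative, coeff_mul, sum_eq_zero] at hn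
      · have : (n : ℝ) + 1 ≠ 0 := by positivity
        simpa [this] using hn
      · intro p hp
        rw [ih p.2 (by have := mem_antidiagonal.1 hp; omega)]
        simp

lemma z_one : z 1 = 1 := by
  have := z_succ 0
  simp [z_zero] at this
  omega

lemma egf_d_eq :
    3 * egf (d · 0) = (2 * X - 1) * d⁄dX ℝ (egf z) + 2 * egf z - 1 := by
  rw [← sub_eq_zero]
  have h2 : d⁄dX ℝ (d⁄dX ℝ (egf z)) = (2 * egf z - 1) * d⁄dX ℝ (egf z) := by
    conv_lhs => rw [derivative_egf_z]
    simp only [map_add, map_sub, pow_two, Derivation.leibniz, smul_eq_mul, Derivation.map_one_eq_zero]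
    ring
  have e2 : d⁄dX ℝ (2 : ℝ⟦X⟧) = 0 := by
    rw [← one_add_one_eq_two, map_add, Derivation.map_one_eq_zero, add_zero]
  have e3 : d⁄dX ℝ (3 : ℝ⟦X⟧) = 0 := by
    rw [← two_add_one_eq_three, map_add, Derivation.map_one_eq_zero, e2, add_zero]
  refine eq_zero_of_derivative_eq_mul (G := 2 * egf z - 1) ?_ ?_
  · simp only [map_add, map_sub, Derivation.leibniz, smul_eq_mul, Derivation.map_one_eq_zero, h2,
      e2, e3, derivative_X, derivative_egf_d]
    linear_combination (-4 : ℝ⟦X⟧) * derivative_egf_z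
  · have hz := coeff_derivative_egf z 0
    have hz' := coeff_egf z 0
    have hd' := coeff_egf (d · 0) 0
    simp only [coeff_zero_eq_constantCoeff] at *
    simp [hz, hz', hd', z_zero, z_one, d_zero, show constantCoeff (2 : ℝ⟦X⟧) = 2 from map_ofNat _ 2]
    norm_num

/-- The number of leaves in terms of the number of trees. -/
lemma three_mul_d {n : ℕ} (hn : n ≠ 0) : 3 * (d n 0 : ℝ) = 2 * (n + 1) * z n - z (n + 1) := by
  obtain ⟨n, rfl⟩ := Nat.exists_eq_succ_of_ne_zero hn
  have h := congrArg (coeff (n + 1)) egf_d_eq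
  have e : ((2 : ℝ⟦X⟧) * X - 1) * d⁄dX ℝ (egf z) =
      X * d⁄dX ℝ (egf z) + X * d⁄dX ℝ (egf z) - d⁄dX ℝ (egf z) := by ring
  have e3 : (3 : ℝ⟦X⟧) * egf (d · 0) = egf (d · 0) + egf (d · 0) + egf (d · 0) := by ring
  rw [e, e3, two_mul (egf z)] at h
  simp only [map_add, map_sub, coeff_succ_X_mul, coeff_derivative_egf, coeff_egf, coeff_one] at h
  rw [Nat.factorial_succ] at h
  push_cast at h ⊢
  field_simp at h
  simp at h
  linarith

open Filter Topology

/-- The dominant singularity of the exponential generating function of plane 1-2 trees. -/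
noncomputable def singularity : ℝ := 2 * Real.pi / (3 * √3)

lemma singularity_pos : 0 < singularity := by
  unfold singularity; positivity

/-- The phase of the trigonometric functions in the closed form of the generating function. -/
noncomputable def phase (w : ℂ) : ℂ := (√3 : ℂ) / 2 * w + Real.pi / 6

lemma sqrt_three_ne_zero : (√3 : ℂ) ≠ 0 := by
  simp

lemma sqrt_three_sq : (√3 : ℂ) ^ 2 = 3 := by
  rw [← Complex.ofReal_pow, Real.sq_sqrt (by norm_num)]; simp

lemma phase_singularity : phase singularity = Real.pi / 2 := by
  have := sqrt_three_ne_zero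
  simp only [phase, singularity]
  push_cast
  field_simp
  ring

lemma hasDerivAt_phase (w : ℂ) : HasDerivAt phase ((√3 : ℂ) / 2) w :=
  (((hasDerivAt_id w).const_mul ((√3 : ℂ) / 2)).add_const ((Real.pi : ℂ) / 6)).congr_deriv
    (mul_one _)

lemma hasDerivAt_cos_phase (w : ℂ) :
    HasDerivAt (fun w => Complex.cos (phase w)) (-Complex.sin (phase w) * ((√3 : ℂ) / 2)) w :=
  (hasDerivAt_phase w).ccos

lemma cos_phase_eq_zero {w : ℂ} (hw : ‖w‖ < 2 * singularity) (h : Complex.cos (phase w) = 0) :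
    w = singularity := by
  obtain ⟨k, hk⟩ := Complex.cos_eq_zero_iff.1 h
  have h3 := sqrt_three_ne_zero
  have hwk : w = ((singularity * (3 * k + 1) : ℝ) : ℂ) := by
    have : (√3 : ℂ) / 2 * w = (2 * k + 1) * Real.pi / 2 - Real.pi / 6 := by
      rw [← hk, phase]; ring
    have h2 : w = 2 / (√3 : ℂ) * ((√3 : ℂ) / 2 * w) := by field_simp
    rw [h2, this, singularity]
    push_cast
    field_simp
    ring
  rw [hwk, Complex.norm_real, Real.norm_eq_abs, abs_mul, abs_of_pos singularity_pos,
    mul_comm, mul_lt_mul_iff_left₀ singularity_pos, abs_lt] at hw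
  have h1 : k < 1 := by
    have : (k : ℝ) < 1 := by linarith
    exact_mod_cast this
  have h2 : -1 < k := by
    have : (-1 : ℝ) < k := by linarith
    exact_mod_cast this
  obtain rfl : k = 0 := by omega
  rw [hwk]; simp

/-- The function `cos ∘ phase` divided by its zero. -/
noncomputable def cosQuotient : ℂ → ℂ := dslope (fun w => Complex.cos (phase w)) singularity

lemma sub_mul_cosQuotient (w : ℂ) :
    (w - singularity) * cosQuotient w = Complex.cos (phase w) := by
  have := sub_smul_dslope (fun w => Complex.cos (phase w)) (singularity : ℂ) w
  simpa [cosQuotient, phase_singularity] using this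

lemma cosQuotient_singularity : cosQuotient singularity = -((√3 : ℂ) / 2) := by
  rw [cosQuotient, dslope_same, (hasDerivAt_cos_phase _).deriv, phase_singularity]
  simp

lemma cosQuotient_ne_zero {w : ℂ} (hw : ‖w‖ < 2 * singularity) : cosQuotient w ≠ 0 := by
  intro h
  have hc := sub_mul_cosQuotient w
  rw [h, mul_zero] at hc
  rw [cos_phase_eq_zero hw hc.symm, cosQuotient_singularity] at h
  simp at h

/-- The closed form of the exponential generating function of plane 1-2 trees. -/
noncomputable def treeFun (w : ℂ) : ℂ := (√3 : ℂ) / 2 * Complex.tan (phase w) + 1 / 2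

/-- The product of `treeFun` with `singularity - w`, without its removable singularity. -/
noncomputable def regularPart (w : ℂ) : ℂ :=
  -Complex.sin (phase w) * ((√3 : ℂ) / 2) / cosQuotient w + (singularity - w) / 2

lemma cos_phase_ne_zero {w : ℂ} (hw : ‖w‖ < singularity) : Complex.cos (phase w) ≠ 0 := by
  intro h
  have := cos_phase_eq_zero (by linarith [singularity_pos]) h
  rw [this, Complex.norm_real, Real.norm_of_nonneg singularity_pos.le] at hw
  exact hw.false

lemma regularPart_eq {w : ℂ} (hw : ‖w‖ < singularity) :
    regularPart w = (singularity - w) * treeFun w := by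
  have hc := cos_phase_ne_zero hw
  have hq := sub_mul_cosQuotient w
  have hq0 : cosQuotient w ≠ 0 := cosQuotient_ne_zero (by linarith [singularity_pos])
  rw [regularPart, treeFun, Complex.tan_eq_sin_div_cos]
  field_simp
  rw [← hq]
  ring

lemma regularPart_singularity : regularPart singularity = 1 := by
  have := sqrt_three_ne_zero
  rw [regularPart, cosQuotient_singularity, phase_singularity]
  simp [this]

lemma differentiableOn_regularPart :
    DifferentiableOn ℂ regularPart (Metric.ball 0 (2 * singularity)) := by
  have hq : DifferentiableOn ℂ cosQuotient (Metric.ball 0 (2 * singularity)) := by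
    refine (Complex.differentiableOn_dslope (Metric.isOpen_ball.mem_nhds ?_)).2
      fun w _ => (hasDerivAt_cos_phase w).differentiableAt.differentiableWithinAt
    rw [mem_ball_zero_iff, Complex.norm_real, Real.norm_of_nonneg singularity_pos.le]
    linarith [singularity_pos]
  have hs : DifferentiableOn ℂ (fun w => Complex.sin (phase w))
      (Metric.ball 0 (2 * singularity)) := fun w _ =>
    (hasDerivAt_phase w).csin.differentiableAt.differentiableWithinAt
  refine ((hs.neg.mul_const _).div hq fun w hw => ?_).add (by fun_prop)
  exact cosQuotient_ne_zero (by simpa using hw)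

lemma hasDerivAt_treeFun {w : ℂ} (hw : ‖w‖ < singularity) :
    HasDerivAt treeFun (treeFun w * treeFun w - treeFun w + 1) w := by
  have hc := cos_phase_ne_zero hw
  have h := (((Complex.hasDerivAt_tan hc).comp w (hasDerivAt_phase w)).const_mul
    ((√3 : ℂ) / 2)).add_const (1 / 2 : ℂ)
  refine h.congr_deriv ?_
  rw [treeFun, Complex.tan_eq_sin_div_cos]
  field_simp
  have h1 := Complex.sin_sq_add_cos_sq (phase w)
  have h3 := sqrt_three_sq
  linear_combination (1 - Complex.sin (phase w) ^ 2) * h3 - 3 * h1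

lemma treeFun_zero : treeFun 0 = 1 := by
  have ht : Complex.tan (Real.pi / 6) = 1 / (√3 : ℂ) := by
    exact_mod_cast congrArg Complex.ofReal Real.tan_pi_div_six
  have h3 := sqrt_three_ne_zero
  rw [treeFun, phase, mul_zero, zero_add, ht]
  field_simp
  norm_num

lemma eventually_norm_lt : ∀ᶠ w : ℂ in 𝓝 0, ‖w‖ < singularity := by
  filter_upwards [Metric.ball_mem_nhds (0 : ℂ) singularity_pos] with w hw
  simpa using hw

lemma contDiffAt_treeFun (n : WithTop ℕ∞) : ContDiffAt ℂ n treeFun 0 := by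
  have : DifferentiableOn ℂ treeFun (Metric.ball 0 singularity) := fun w hw =>
    (hasDerivAt_treeFun (by simpa using hw)).differentiableAt.differentiableWithinAt
  exact (this.analyticAt (Metric.ball_mem_nhds _ singularity_pos)).contDiffAt

lemma iteratedDeriv_treeFun (n : ℕ) : iteratedDeriv n treeFun 0 = z n := by
  induction n using Nat.strong_induction_on with
  | _ n ih =>
    cases n with
    | zero => simp [treeFun_zero, z_zero]
    | succ n =>
      have hd : deriv treeFun =ᶠ[𝓝 0] treeFun * treeFun - treeFun + fun _ => 1 := by
        filter_upwards [eventually_norm_lt] with w hw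
        exact (hasDerivAt_treeFun hw).deriv
      have hc := contDiffAt_treeFun n
      have hc2 : ContDiffAt ℂ n (treeFun * treeFun) 0 := hc.mul hc
      have hc3 : ContDiffAt ℂ n (treeFun * treeFun - treeFun) 0 := hc2.sub hc
      rw [iteratedDeriv_succ', hd.iteratedDeriv_eq,
        iteratedDeriv_add hc3 contDiffAt_const,
        iteratedDeriv_sub hc2 hc, iteratedDeriv_mul hc hc, iteratedDeriv_const,
        ih n (by omega)]
      have h := congrArg (Nat.cast (R := ℂ)) (z_succ n)
      push_cast at h
      rw [eq_sub_of_add_eq h]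
      rw [sum_congr rfl fun i hi => by
        rw [ih i (by have := mem_range.1 hi; omega), ih (n - i) (by omega)]]
      ring

lemma iteratedDeriv_succ_regularPart (n : ℕ) :
    iteratedDeriv (n + 1) regularPart 0 = singularity * z (n + 1) - (n + 1) * z n := by
  have he : regularPart =ᶠ[𝓝 0] (fun w => (singularity - w : ℂ)) * treeFun := by
    filter_upwards [eventually_norm_lt] with w hw
    exact regularPart_eq hw
  have hd : deriv (fun w => (singularity - w : ℂ)) = fun _ => -1 := by
    ext w
    simp
  rw [he.iteratedDeriv_eq, iteratedDeriv_mul (by fun_prop) (contDiffAt_treeFun _),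
    sum_range_succ', sum_range_succ', sum_eq_zero]
  · simp [iteratedDeriv_treeFun, hd]
    ring
  · intro i _
    rw [iteratedDeriv_succ', hd, iteratedDeriv_const]
    simp

lemma tendsto_z_mul_pow :
    Tendsto (fun n => (z n : ℝ) / n.factorial * singularity ^ (n + 1)) atTop (𝓝 1) := by
  have hmem : (singularity : ℂ) ∈ Metric.ball (0 : ℂ) (2 * singularity) := by
    rw [mem_ball_zero_iff, Complex.norm_real, Real.norm_of_nonneg singularity_pos.le]
    linarith [singularity_pos]
  have h := ((Complex.hasSum_taylorSeries_on_ball differentiableOn_regularPart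
    hmem).tendsto_sum_nat.comp (tendsto_add_atTop_nat 1))
  rw [regularPart_singularity] at h
  have key (n : ℕ) : ∑ i ∈ range (n + 1), ((i.factorial : ℂ)⁻¹ • ((singularity : ℂ) - 0) ^ i •
      iteratedDeriv i regularPart 0) =
        (((z n : ℝ) / n.factorial * singularity ^ (n + 1) : ℝ) : ℂ) := by
    induction n with
    | zero =>
      simp [regularPart_eq (w := 0) (by simpa using singularity_pos), treeFun_zero, z_zero]
    | succ n ih =>
      rw [sum_range_succ, ih, iteratedDeriv_succ_regularPart, Nat.factorial_succ]
      push_cast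
      have h1 : (n : ℂ) + 1 ≠ 0 := by exact_mod_cast n.succ_ne_zero
      have h2 : (n.factorial : ℂ) ≠ 0 := by exact_mod_cast n.factorial_ne_zero
      simp only [smul_eq_mul, sub_zero]
      field_simp
      ring
  have h' : Tendsto (fun n : ℕ =>
      (((z n : ℝ) / n.factorial * singularity ^ (n + 1) : ℝ) : ℂ)) atTop (𝓝 1) :=
    h.congr key
  simpa only [Function.comp_def, Complex.ofReal_re, Complex.one_re] using
    (Complex.continuous_re.tendsto 1).comp h'

lemma tendsto_z_ratio :
    Tendsto (fun n : ℕ => (z (n + 1) : ℝ) / ((n + 1) * z n)) atTop (𝓝 (1 / singularity)) := by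
  have h := ((tendsto_z_mul_pow.comp (tendsto_add_atTop_nat 1)).div tendsto_z_mul_pow
    one_ne_zero).div_const singularity
  rw [div_one] at h
  refine h.congr fun n => ?_
  have := singularity_pos.ne'
  have h2 : (n.factorial : ℝ) ≠ 0 := by exact_mod_cast n.factorial_ne_zero
  simp only [Pi.div_apply, Function.comp_apply, Nat.factorial_succ]
  push_cast
  rcases eq_or_ne (z n : ℝ) 0 with h0 | h0
  · simp [h0]
  · field_simp
    ring

lemma eventually_z_ne_zero : ∀ᶠ n in atTop, z n ≠ 0 := by
  filter_upwards [tendsto_z_mul_pow.eventually_ne one_ne_zero] with n hn h0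
  simp [h0] at hn

end BalancedTrees

open BalancedTrees

/-- `lim_{n→∞} d(n,0)/(n·z(n))` exists and equals `2/3 - √3/(2π)`: for large
`n`, the probability that a uniformly random vertex of all plane 1-2 trees on
`{1,…,n}` is a leaf tends to `2/3 - √3/(2π)`. -/
theorem statement19 :
    Filter.Tendsto (fun n : ℕ => (d n 0 : ℝ) / ((n : ℝ) * (z n : ℝ)))
      Filter.atTop (nhds (2 / 3 - Real.sqrt 3 / (2 * Real.pi))) := by
  have hn : Filter.Tendsto (fun n : ℕ => (n + 1 : ℝ) / n) Filter.atTop (nhds 1) := by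
    have h := (tendsto_one_div_atTop_nhds_zero_nat (𝕜 := ℝ)).const_add 1
    rw [add_zero] at h
    refine h.congr' ?_
    filter_upwards [Filter.eventually_ne_atTop 0] with n h0
    have h0' : (n : ℝ) ≠ 0 := by exact_mod_cast h0
    field_simp
  have h := ((hn.const_mul (2 / 3)).sub ((hn.mul tendsto_z_ratio).const_mul (1 / 3)))
  have hlim : 2 / 3 * 1 - 1 / 3 * (1 * (1 / singularity)) =
      2 / 3 - Real.sqrt 3 / (2 * Real.pi) := by
    rw [singularity]
    have : √3 ≠ 0 := by positivity
    field_simp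
  rw [hlim] at h
  refine h.congr' ?_
  filter_upwards [eventually_z_ne_zero, Filter.eventually_ne_atTop 0] with n hz h0
  have hz' : (z n : ℝ) ≠ 0 := by exact_mod_cast hz
  have h0' : (n : ℝ) ≠ 0 := by exact_mod_cast h0
  have h1 : (n : ℝ) + 1 ≠ 0 := by positivity
  have hd := three_mul_d h0
  field_simp
  linarith
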